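/- The polynomial f(x) = (x² − 7)(x² − 11)(x² − 19)(x² − 31)(x² − 209) has a root modulo every positive integer but has no rational root. -/

import Mathlib

/-- Hensel lifting of square roots modulo an odd prime. -/
theorem exists_pow_dvd_sq_sub_of_dvd {p : ℕ} (hp : p.Prime) (hp2 : p ≠ 2) {a : ℤ}
    (ha : ¬ (p : ℤ) ∣ a) {x₀ : ℤ} (hx₀ : (p : ℤ) ∣ x₀ ^ 2 - a) (k : ℕ) :
    ∃ x : ℤ, (p : ℤ) ^ (k + 1) ∣ x ^ 2 - a := by
  induction k with
  | zero => exact ⟨x₀, by simpa using hx₀⟩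
  | succ k ih =>
    obtain ⟨x, t, ht⟩ := ih
    have hpZ : Prime (p : ℤ) := Nat.prime_iff_prime_int.mp hp
    have hx : ¬ (p : ℤ) ∣ 2 * x := by
      intro h
      rcases hpZ.dvd_or_dvd h with h | h
      · have h' : p ∣ 2 := by exact_mod_cast h
        exact hp2 ((Nat.prime_dvd_prime_iff_eq hp Nat.prime_two).mp h')
      · apply ha
        have h1 : (p : ℤ) ∣ x ^ 2 := dvd_pow h two_ne_zero
        have h2 : (p : ℤ) ∣ x ^ 2 - a := by
          rw [ht, pow_succ]
          exact ⟨p ^ k * t, by ring⟩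
        simpa using dvd_sub h1 h2
    obtain ⟨u, v, huv⟩ := (hpZ.coprime_iff_not_dvd.mpr hx)
    refine ⟨x - p ^ (k + 1) * (v * t), u * t + p ^ k * (v * t) ^ 2, ?_⟩
    linear_combination ht - p ^ (k + 1) * t * huv

/-- An integer congruent to `1` modulo `8` is a square modulo every power of two. -/
theorem exists_two_pow_dvd_sq_sub {a : ℤ} (ha : 8 ∣ a - 1) (k : ℕ) :
    ∃ x : ℤ, (2 : ℤ) ^ k ∣ x ^ 2 - a := by
  suffices h : ∃ x : ℤ, Odd x ∧ (2 : ℤ) ^ (k + 3) ∣ x ^ 2 - a by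
    obtain ⟨x, -, hx⟩ := h
    exact ⟨x, (pow_dvd_pow 2 (by omega)).trans hx⟩
  induction k with
  | zero => exact ⟨1, odd_one, by rw [← dvd_neg]; simpa using ha⟩
  | succ k ih =>
    obtain ⟨x, ⟨y, rfl⟩, t, ht⟩ := ih
    refine ⟨2 * y + 1 + 2 ^ (k + 2) * t, ⟨y + 2 ^ (k + 1) * t, by ring⟩,
      t + y * t + 2 ^ k * t ^ 2, ?_⟩
    linear_combination ht

/-- Modulo a prime, one of `a`, `b`, `a * b` is a square. -/
theorem exists_dvd_sq_sub_or_mul (p : ℕ) [Fact p.Prime] (a b : ℤ) :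
    (∃ x : ℤ, (p : ℤ) ∣ x ^ 2 - a) ∨ (∃ x : ℤ, (p : ℤ) ∣ x ^ 2 - b) ∨
      ∃ x : ℤ, (p : ℤ) ∣ x ^ 2 - a * b := by
  have lift (c : ℤ) (hc : IsSquare (c : ZMod p)) : ∃ x : ℤ, (p : ℤ) ∣ x ^ 2 - c := by
    obtain ⟨y, hy⟩ := hc
    obtain ⟨x, rfl⟩ := ZMod.intCast_surjective y
    refine ⟨x, (ZMod.intCast_zmod_eq_zero_iff_dvd _ p).mp ?_⟩
    push_cast
    rw [hy]
    ring
  by_cases h₁ : IsSquare (a : ZMod p)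
  · exact .inl (lift a h₁)
  by_cases h₂ : IsSquare (b : ZMod p)
  · exact .inr (.inl (lift b h₂))
  refine .inr (.inr (lift _ ?_))
  have h₁' := (legendreSym.eq_neg_one_iff p).mpr h₁
  have h₂' := (legendreSym.eq_neg_one_iff p).mpr h₂
  have h : legendreSym p (a * b) = 1 := by rw [legendreSym.mul, h₁', h₂']; norm_num
  by_contra hns
  rw [(legendreSym.eq_neg_one_iff p).mpr hns] at h
  norm_num at h

/-- By the Chinese remainder theorem, a polynomial with a root modulo every prime power has a
root modulo every positive integer. -/
theorem Polynomial.exists_dvd_eval_of_prime_pow (f : Polynomial ℤ)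
    (hf : ∀ p k : ℕ, p.Prime → ∃ x : ℤ, (p : ℤ) ^ (k + 1) ∣ f.eval x) (m : ℕ) (hm : 0 < m) :
    ∃ x : ℤ, (m : ℤ) ∣ f.eval x := by
  induction m using Nat.recOnPosPrimePosCoprime with
  | zero => omega
  | one => exact ⟨0, by simp⟩
  | prime_pow p n hp hn =>
    obtain ⟨k, rfl⟩ := Nat.exists_eq_succ_of_ne_zero hn.ne'
    simpa using hf p k hp
  | coprime a b ha hb hab iha ihb =>
    obtain ⟨x, hx⟩ := iha (by omega)
    obtain ⟨y, hy⟩ := ihb (by omega)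
    have hab' : IsCoprime (a : ℤ) b := Nat.isCoprime_iff_coprime.mpr hab
    have ⟨u, v, huv⟩ := hab'
    have hzx : (a : ℤ) ∣ y * (u * a) + x * (v * b) - x :=
      ⟨u * (y - x), by linear_combination x * huv⟩
    have hzy : (b : ℤ) ∣ y * (u * a) + x * (v * b) - y :=
      ⟨v * (x - y), by linear_combination y * huv⟩
    refine ⟨y * (u * a) + x * (v * b), ?_⟩
    push_cast
    refine hab'.mul_dvd ?_ ?_
    · exact (dvd_iff_dvd_of_dvd_sub (hzx.trans (f.sub_dvd_eval_sub _ _))).mpr hx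
    · exact (dvd_iff_dvd_of_dvd_sub (hzy.trans (f.sub_dvd_eval_sub _ _))).mpr hy

/-- For every prime `p` some fixed `a` among `11`, `19`, `31`, `209` is a square modulo all
powers of `p`. -/
theorem exists_prime_pow_dvd_sq_sub {p : ℕ} (hp : p.Prime) (k : ℕ) :
    ∃ a ∈ ({11, 19, 31, 209} : Set ℤ), ∃ x : ℤ, (p : ℤ) ^ (k + 1) ∣ x ^ 2 - a := by
  have := Fact.mk hp
  by_cases h2 : p = 2
  · subst h2
    exact ⟨209, by simp, exists_two_pow_dvd_sq_sub (by norm_num) _⟩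
  by_cases h11 : p = 11
  · subst h11
    exact ⟨31, by simp, exists_pow_dvd_sq_sub_of_dvd hp h2 (by norm_num) (x₀ := 3) (by norm_num) k⟩
  by_cases h19 : p = 19
  · subst h19
    exact ⟨11, by simp, exists_pow_dvd_sq_sub_of_dvd hp h2 (by norm_num) (x₀ := 7) (by norm_num) k⟩
  have hd11 : ¬ (p : ℤ) ∣ 11 := fun h =>
    h11 ((Nat.prime_dvd_prime_iff_eq hp (by norm_num)).mp (by exact_mod_cast h))
  have hd19 : ¬ (p : ℤ) ∣ 19 := fun h =>
    h19 ((Nat.prime_dvd_prime_iff_eq hp (by norm_num)).mp (by exact_mod_cast h))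
  rcases exists_dvd_sq_sub_or_mul p 11 19 with ⟨x, hx⟩ | ⟨x, hx⟩ | ⟨x, hx⟩
  · exact ⟨11, by simp, exists_pow_dvd_sq_sub_of_dvd hp h2 hd11 hx k⟩
  · exact ⟨19, by simp, exists_pow_dvd_sq_sub_of_dvd hp h2 hd19 hx k⟩
  · refine ⟨209, by simp, exists_pow_dvd_sq_sub_of_dvd hp h2 (fun h => ?_)
      (by norm_num at hx; exact hx) k⟩
    have h' : (p : ℤ) ∣ 11 * 19 := by norm_num; exact h
    exact ((Nat.prime_iff_prime_int.mp hp).dvd_or_dvd h').elim hd11 hd19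

/-- A natural number strictly between consecutive squares is not the square of a rational. -/
theorem Rat.sq_ne_natCast_of_lt_of_lt {n : ℕ} (b : ℕ) (h₁ : b ^ 2 < n) (h₂ : n < (b + 1) ^ 2)
    (r : ℚ) : r ^ 2 ≠ n := by
  intro h
  have hsq : IsSquare (n : ℚ) := ⟨r, by rw [← h, sq]⟩
  obtain ⟨c, rfl⟩ := Rat.isSquare_natCast_iff.mp hsq
  rw [← sq] at h₁ h₂
  have := lt_of_pow_lt_pow_left₀ 2 (Nat.zero_le _) h₁
  have := lt_of_pow_lt_pow_left₀ 2 (Nat.zero_le _) h₂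
  omega

/-- `f(x) = (x² - 7)(x² - 11)(x² - 19)(x² - 31)(x² - 209)` has a root modulo every
positive integer but no rational root. -/
theorem stmt_14 :
    (∀ m : ℕ, 0 < m → ∃ x : ℤ,
        (m : ℤ) ∣ (x ^ 2 - 7) * (x ^ 2 - 11) * (x ^ 2 - 19) * (x ^ 2 - 31) *
          (x ^ 2 - 209)) ∧
      ¬ ∃ r : ℚ,
        (r ^ 2 - 7) * (r ^ 2 - 11) * (r ^ 2 - 19) * (r ^ 2 - 31) * (r ^ 2 - 209) = 0 := by
  constructor
  · intro m hm
    have h := Polynomial.exists_dvd_eval_of_prime_pow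
      ((.X ^ 2 - 7) * (.X ^ 2 - 11) * (.X ^ 2 - 19) * (.X ^ 2 - 31) * (.X ^ 2 - 209))
    simp only [Polynomial.eval_mul, Polynomial.eval_sub, Polynomial.eval_pow,
      Polynomial.eval_X, Polynomial.eval_ofNat] at h
    refine h (fun p k hp => ?_) m hm
    obtain ⟨a, ha, x, hx⟩ := exists_prime_pow_dvd_sq_sub hp k
    refine ⟨x, hx.trans ?_⟩
    rcases ha with rfl | rfl | rfl | rfl
    · exact ⟨(x ^ 2 - 7) * (x ^ 2 - 19) * (x ^ 2 - 31) * (x ^ 2 - 209), by ring⟩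
    · exact ⟨(x ^ 2 - 7) * (x ^ 2 - 11) * (x ^ 2 - 31) * (x ^ 2 - 209), by ring⟩
    · exact ⟨(x ^ 2 - 7) * (x ^ 2 - 11) * (x ^ 2 - 19) * (x ^ 2 - 209), by ring⟩
    · exact ⟨(x ^ 2 - 7) * (x ^ 2 - 11) * (x ^ 2 - 19) * (x ^ 2 - 31), by ring⟩
  · rintro ⟨r, hr⟩
    simp only [mul_eq_zero, sub_eq_zero] at hr
    rcases hr with (((h | h) | h) | h) | h
    · exact Rat.sq_ne_natCast_of_lt_of_lt (n := 7) 2 (by norm_num) (by norm_num) r h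
    · exact Rat.sq_ne_natCast_of_lt_of_lt (n := 11) 3 (by norm_num) (by norm_num) r h
    · exact Rat.sq_ne_natCast_of_lt_of_lt (n := 19) 4 (by norm_num) (by norm_num) r h
    · exact Rat.sq_ne_natCast_of_lt_of_lt (n := 31) 5 (by norm_num) (by norm_num) r h
    · exact Rat.sq_ne_natCast_of_lt_of_lt (n := 209) 14 (by norm_num) (by norm_num) r h
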